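/- arXiv:2009.08662 — 2 statements merged into one kernel-verified Lean document; each statement's English description precedes it below -/
import Mathlib

section
/- Let f : ℝⁿ → ℝⁿ and B : ℝⁿ → ℝ^{n×m} be smooth (m < n), B(x) of full column rank, and let B_⊥ : ℝⁿ → ℝ^{n×(n−m)} be smooth with full column rank and B(x)ᵀ B_⊥(x) = 0 for all x. Define the extended drift f̄ : ℝⁿ × ℝᵐ → ℝ^{n+m} by f̄(x, x_c) = (f(x), 0) and the extended input matrix B̄(x, x_c) ∈ ℝ^{(n+m)×2m} as the block-diagonal matrix diag(B(x), I_m), and set B̄_⊥(x, x_c) := col(B_⊥(x), 0_{m×(n−m)}) ∈ ℝ^{(n+m)×(n−m)}. Suppose W̄ : ℝⁿ × ℝᵐ → ℝ^{(n+m)×(n+m)} is a smooth symmetric-matrix-valued map with ā₁ I ⪯ W̄(x, x_c) ⪯ ā₂ I for constants ā₂ ≥ ā₁ > 0, such that for all (x, x_c): (a) B̄_⊥ᵀ(−∂_{f̄} W̄ + Df̄ W̄ + W̄ Df̄ᵀ) B̄_⊥ is negative definite, and (b) for every column B̄_i of B̄ (i = 1,…,2m): ∂_{B̄_i} W̄ −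 DB̄_i W̄ − W̄ DB̄_iᵀ = 0. Let W̄_x(x, x_c) denote the upper-left n×n block of W̄(x, x_c), and define W(x) := W̄_x(x, 0). Then W is smooth, ā₁ I ⪯ W(x) ⪯ ā₂ I, and for all x: B_⊥(x)ᵀ(−∂_f W(x) + Df(x) W(x) + W(x) Df(x)ᵀ) B_⊥(x) is negative definite, and ∂_{B_i} W(x) − DB_i(x) W(x) − W(x) DB_i(x)ᵀ = 0 for each column B_i of B (i = 1,…,m). -/
/- STATEMENT 6: the dual CCM conditions for the integrator-extended system
(state (x, x_c) ∈ ℝⁿ × ℝᵐ, indexed by Fin n ⊕ Fin m, drift f̄ = (f, 0), input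
matrix B̄ = diag(B, I), annihilator B̄_⊥ = col(B_⊥, 0)) imply the dual CCM
conditions for the original system with W(x) := upper-left block of W̄(x, 0). -/

open Matrix

attribute [local instance] Matrix.normedAddCommGroup Matrix.normedSpace

/-- Jacobian matrix of a map between finite-dimensional coordinate spaces. -/
noncomputable def jacM {ι κ : Type*} [Fintype ι] [DecidableEq ι] [Fintype κ]
    (f : (ι → ℝ) → (κ → ℝ)) (x : ι → ℝ) : Matrix κ ι ℝ :=
  Matrix.of fun k j => fderiv ℝ f x (Pi.single j 1) k

/-- Extended drift f̄(x, x_c) = (f(x), 0). -/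
def extDrift {n m : ℕ} (f : (Fin n → ℝ) → (Fin n → ℝ)) :
    ((Fin n ⊕ Fin m) → ℝ) → ((Fin n ⊕ Fin m) → ℝ) :=
  fun χ => Sum.elim (f (χ ∘ Sum.inl)) 0

/-- Extended input matrix B̄(x, x_c) = diag(B(x), I_m). -/
def extInput {n m : ℕ} (B : (Fin n → ℝ) → Matrix (Fin n) (Fin m) ℝ) :
    ((Fin n ⊕ Fin m) → ℝ) → Matrix (Fin n ⊕ Fin m) (Fin m ⊕ Fin m) ℝ :=
  fun χ => Matrix.fromBlocks (B (χ ∘ Sum.inl)) 0 0 (1 : Matrix (Fin m) (Fin m) ℝ)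

/-- Extended annihilator B̄_⊥(x, x_c) = col(B_⊥(x), 0). -/
def extAnnih {n m : ℕ} (Bp : (Fin n → ℝ) → Matrix (Fin n) (Fin (n - m)) ℝ) :
    ((Fin n ⊕ Fin m) → ℝ) → Matrix (Fin n ⊕ Fin m) (Fin (n - m)) ℝ :=
  fun χ => Matrix.of fun i j => Sum.elim (fun a => Bp (χ ∘ Sum.inl) a j) (fun _ => (0 : ℝ)) i

/-- Upper-left n×n block of W̄, evaluated at extended state (x, 0). -/
def upperLeft {n m : ℕ}
    (Wbar : ((Fin n ⊕ Fin m) → ℝ) → Matrix (Fin n ⊕ Fin m) (Fin n ⊕ Fin m) ℝ) :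
    (Fin n → ℝ) → Matrix (Fin n) (Fin n) ℝ :=
  fun x => Matrix.of fun i j => Wbar (Sum.elim x 0) (Sum.inl i) (Sum.inl j)

/-- The embedding x ↦ (x, 0). -/
noncomputable def embL (n m : ℕ) : (Fin n → ℝ) →L[ℝ] ((Fin n ⊕ Fin m) → ℝ) :=
  LinearMap.toContinuousLinearMap
    { toFun := fun x => Sum.elim x 0
      map_add' := by intro x y; ext k; cases k <;> simp
      map_smul' := by intro c x; ext k; cases k <;> simp }

/-- The projection (x, x_c) ↦ x. -/
noncomputable def prjL (n m : ℕ) : ((Fin n ⊕ Fin m) → ℝ) →L[ℝ] (Fin n → ℝ) :=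
  LinearMap.toContinuousLinearMap
    { toFun := fun χ => χ ∘ Sum.inl
      map_add' := by intro x y; rfl
      map_smul' := by intro c x; rfl }

/-- The upper-left block as a linear map. -/
noncomputable def blkL (n m : ℕ) :
    Matrix (Fin n ⊕ Fin m) (Fin n ⊕ Fin m) ℝ →L[ℝ] Matrix (Fin n) (Fin n) ℝ :=
  LinearMap.toContinuousLinearMap
    { toFun := fun M => M.toBlocks₁₁
      map_add' := by intro x y; rfl
      map_smul' := by intro c x; rfl }

theorem upperLeft_eq {n m : ℕ}
    (Wbar : ((Fin n ⊕ Fin m) → ℝ) → Matrix (Fin n ⊕ Fin m) (Fin n ⊕ Fin m) ℝ) :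
    upperLeft Wbar = fun x => blkL n m (Wbar (embL n m x)) := rfl

theorem fderiv_upperLeft {n m : ℕ}
    (Wbar : ((Fin n ⊕ Fin m) → ℝ) → Matrix (Fin n ⊕ Fin m) (Fin n ⊕ Fin m) ℝ)
    (hW : Differentiable ℝ Wbar) (x v : Fin n → ℝ) :
    fderiv ℝ (upperLeft Wbar) x v
      = (fderiv ℝ Wbar (Sum.elim x 0) (Sum.elim v 0)).toBlocks₁₁ := by
  have h1 : HasFDerivAt (fun y => Wbar (embL n m y))
      ((fderiv ℝ Wbar (embL n m x)).comp (embL n m)) x :=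
    ((hW (embL n m x)).hasFDerivAt).comp x (embL n m).hasFDerivAt
  have h2 : HasFDerivAt (upperLeft Wbar)
      ((blkL n m).comp ((fderiv ℝ Wbar (embL n m x)).comp (embL n m))) x :=
    ((blkL n m).hasFDerivAt).comp x h1
  rw [h2.fderiv]
  rfl

theorem jacM_extDrift {n m : ℕ} (g : (Fin n → ℝ) → (Fin n → ℝ))
    (hg : Differentiable ℝ g) (x : Fin n → ℝ) :
    jacM (extDrift (m := m) g) (Sum.elim x 0) = Matrix.fromBlocks (jacM g x) 0 0 0 := by
  have hx : prjL n m (Sum.elim x 0) = x := rfl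
  have h1 : HasFDerivAt (fun χ => g (prjL n m χ)) ((fderiv ℝ g x).comp (prjL n m))
      (Sum.elim x 0) := by
    refine HasFDerivAt.comp (Sum.elim x 0) ?_ (prjL n m).hasFDerivAt
    rw [hx]
    exact (hg x).hasFDerivAt
  have h2 : HasFDerivAt (extDrift (m := m) g)
      ((embL n m).comp ((fderiv ℝ g x).comp (prjL n m))) (Sum.elim x 0) :=
    ((embL n m).hasFDerivAt).comp _ h1
  have hl : ∀ j : Fin n, prjL n m (Pi.single (Sum.inl j) 1) = Pi.single j 1 := by
    intro j; ext k
    simp [prjL, Pi.single_apply]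
  have hr : ∀ j : Fin m, prjL n m (Pi.single (Sum.inr j) 1) = 0 := by
    intro j; ext k
    simp [prjL]
  ext k j
  simp only [jacM, h2.fderiv, Matrix.of_apply, ContinuousLinearMap.comp_apply]
  rcases j with j | j
  · rw [hl]
    rcases k with k | k <;> simp [embL]
  · rw [hr]
    rcases k with k | k <;> simp [embL]

theorem blk_expr {n m : ℕ} (M W : Matrix (Fin n ⊕ Fin m) (Fin n ⊕ Fin m) ℝ)
    (J : Matrix (Fin n) (Fin n) ℝ) :
    (Matrix.fromBlocks J 0 0 (0 : Matrix (Fin m) (Fin m) ℝ) * W).toBlocks₁₁ = J * W.toBlocks₁₁ ∧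
    (W * (Matrix.fromBlocks J 0 0 (0 : Matrix (Fin m) (Fin m) ℝ))ᵀ).toBlocks₁₁
      = W.toBlocks₁₁ * Jᵀ := by
  constructor <;> ext i j <;>
    simp [Matrix.toBlocks₁₁, Matrix.mul_apply, Fintype.sum_sum_type]

theorem stmt6 {n m : ℕ} (hmn : m < n)
    (f : (Fin n → ℝ) → (Fin n → ℝ)) (hf : ContDiff ℝ (⊤ : ℕ∞) f)
    (B : (Fin n → ℝ) → Matrix (Fin n) (Fin m) ℝ) (hB : ContDiff ℝ (⊤ : ℕ∞) B)
    (hBrank : ∀ x, Function.Injective (B x).mulVec)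
    (Bp : (Fin n → ℝ) → Matrix (Fin n) (Fin (n - m)) ℝ) (hBp : ContDiff ℝ (⊤ : ℕ∞) Bp)
    (hBprank : ∀ x, Function.Injective (Bp x).mulVec)
    (hannih : ∀ x, (B x)ᵀ * Bp x = 0)
    (Wbar : ((Fin n ⊕ Fin m) → ℝ) → Matrix (Fin n ⊕ Fin m) (Fin n ⊕ Fin m) ℝ)
    (hWbar : ContDiff ℝ (⊤ : ℕ∞) Wbar) (hWbarsymm : ∀ χ, (Wbar χ).IsSymm)
    (c₁ c₂ : ℝ) (hc₁ : 0 < c₁) (hc₁₂ : c₁ ≤ c₂)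
    (hWbarbound : ∀ (χ : (Fin n ⊕ Fin m) → ℝ) (v : (Fin n ⊕ Fin m) → ℝ),
      c₁ * (v ⬝ᵥ v) ≤ v ⬝ᵥ (Wbar χ *ᵥ v) ∧ v ⬝ᵥ (Wbar χ *ᵥ v) ≤ c₂ * (v ⬝ᵥ v))
    -- (a) dual contraction LMI for the extended system
    (ha : ∀ (χ : (Fin n ⊕ Fin m) → ℝ) (w : Fin (n - m) → ℝ), w ≠ 0 →
      w ⬝ᵥ (((extAnnih Bp χ)ᵀ
        * (-(fderiv ℝ Wbar χ (extDrift f χ)) + jacM (extDrift f) χ * Wbar χ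
            + Wbar χ * (jacM (extDrift f) χ)ᵀ)
        * extAnnih Bp χ) *ᵥ w) < 0)
    -- (b) dual PDE for every column of B̄
    (hb : ∀ (χ : (Fin n ⊕ Fin m) → ℝ) (i : Fin m ⊕ Fin m),
      fderiv ℝ Wbar χ (fun k => extInput B χ k i)
        - jacM (fun χ' k => extInput B χ' k i) χ * Wbar χ
        - Wbar χ * (jacM (fun χ' k => extInput B χ' k i) χ)ᵀ = 0) :
    -- conclusions for W(x) := W̄_x(x, 0)
    ContDiff ℝ (⊤ : ℕ∞) (upperLeft Wbar) ∧
    (∀ (x v : Fin n → ℝ), c₁ * (v ⬝ᵥ v) ≤ v ⬝ᵥ (upperLeft Wbar x *ᵥ v) ∧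
        v ⬝ᵥ (upperLeft Wbar x *ᵥ v) ≤ c₂ * (v ⬝ᵥ v)) ∧
    (∀ (x : Fin n → ℝ) (w : Fin (n - m) → ℝ), w ≠ 0 →
      w ⬝ᵥ (((Bp x)ᵀ
        * (-(fderiv ℝ (upperLeft Wbar) x (f x)) + jacM f x * upperLeft Wbar x
            + upperLeft Wbar x * (jacM f x)ᵀ)
        * Bp x) *ᵥ w) < 0) ∧
    (∀ (x : Fin n → ℝ) (i : Fin m),
      fderiv ℝ (upperLeft Wbar) x (fun k => B x k i)
        - jacM (fun y k => B y k i) x * upperLeft Wbar x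
        - upperLeft Wbar x * (jacM (fun y k => B y k i) x)ᵀ = 0) := by
  have hWd : Differentiable ℝ Wbar := hWbar.differentiable (by simp)
  refine ⟨?_, ?_, ?_, ?_⟩
  · rw [upperLeft_eq]
    exact (blkL n m).contDiff.comp (hWbar.comp (embL n m).contDiff)
  · intro x v
    have h := hWbarbound (Sum.elim x 0) (Sum.elim v 0)
    have e1 : (Sum.elim v (0 : Fin m → ℝ)) ⬝ᵥ (Sum.elim v 0) = v ⬝ᵥ v := by
      simp [dotProduct, Fintype.sum_sum_type]
    have e2 : (Sum.elim v (0 : Fin m → ℝ)) ⬝ᵥ (Wbar (Sum.elim x 0) *ᵥ (Sum.elim v 0))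
        = v ⬝ᵥ (upperLeft Wbar x *ᵥ v) := by
      simp [dotProduct, Matrix.mulVec, Fintype.sum_sum_type, upperLeft]
    rwa [e1, e2] at h
  · intro x w hw
    have h := ha (Sum.elim x 0) w hw
    have hd : extDrift (m := m) f (Sum.elim x 0) = Sum.elim (f x) 0 := rfl
    rw [jacM_extDrift f (hf.differentiable (by simp)) x, hd] at h
    have key : ∀ M : Matrix (Fin n ⊕ Fin m) (Fin n ⊕ Fin m) ℝ,
        (extAnnih Bp (Sum.elim x 0))ᵀ * M * extAnnih Bp (Sum.elim x 0)
          = (Bp x)ᵀ * M.toBlocks₁₁ * Bp x := by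
      intro M
      have hc : (Sum.elim x (0 : Fin m → ℝ)) ∘ Sum.inl = x := rfl
      ext i j
      simp [Matrix.mul_apply, Fintype.sum_sum_type, extAnnih, Matrix.toBlocks₁₁, hc]
    rw [key] at h
    have hbk := blk_expr (Wbar (Sum.elim x 0)) (Wbar (Sum.elim x 0)) (jacM f x)
    rw [fderiv_upperLeft Wbar hWd]
    have hU : upperLeft Wbar x = (Wbar (Sum.elim x 0)).toBlocks₁₁ := rfl
    rw [hU, ← hbk.1, ← hbk.2]
    exact h
  · intro x i
    have h := hb (Sum.elim x 0) (Sum.inl i)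
    have hcol : (fun (χ' : (Fin n ⊕ Fin m) → ℝ) k => extInput B χ' k (Sum.inl i))
        = extDrift (m := m) (fun y k => B y k i) := by
      funext χ k
      rcases k with k | k <;> simp [extInput, extDrift]
    have hBd : Differentiable ℝ (fun y k => B y k i) := by
      have hB' : Differentiable ℝ B := hB.differentiable (by simp)
      rw [differentiable_pi]
      intro k
      have h1 := (differentiable_pi (𝕜 := ℝ) (Φ := fun y a => B y a)).1 hB' k
      exact (differentiable_pi (𝕜 := ℝ) (Φ := fun y b => B y k b)).1 h1 i
    have hd : (fun k => extInput B (Sum.elim x 0) k (Sum.inl i))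
        = Sum.elim (fun k => B x k i) (0 : Fin m → ℝ) :=
      congrFun hcol (Sum.elim x 0)
    rw [hcol, jacM_extDrift _ hBd x, hd] at h
    have hbk := blk_expr (Wbar (Sum.elim x 0)) (Wbar (Sum.elim x 0))
      (jacM (fun y k => B y k i) x)
    rw [fderiv_upperLeft Wbar hWd]
    have hU : upperLeft Wbar x = (Wbar (Sum.elim x 0)).toBlocks₁₁ := rfl
    rw [hU, ← hbk.1, ← hbk.2]
    exact congrArg Matrix.toBlocks₁₁ h
end

section
/- Let f : ℝⁿ → ℝⁿ and B : ℝⁿ → ℝ^{n×m} be smooth with B(x) of full column rank for every x (m < n). Let V : ℝⁿ × ℝⁿ → ℝ be twice continuously differentiable with a₁‖x − ξ‖² ≤ V(x, ξ) ≤ a₂‖x − ξ‖² for all x, ξ (a₂ ≥ a₁ > 0), let λ > 0, c > 0, and let K : ℝⁿ → ℝ^{m×n} be continuous. Assume that for every x* ∈ ℝⁿ and every u* ∈ ℝᵐ there exists a continuously differentiable feedback α : ℝⁿ → ℝᵐ with α(x*) = u* and Dα(x*) = K(x*) such that for all x, ξ ∈ ℝⁿ and all w₁, w₂ ∈ ℝⁿ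 with ‖w₁ − w₂‖ ≤ c‖x − ξ‖: D₁V(x,ξ)[f(x) + B(x)α(x) + w₁] + D₂V(x,ξ)[f(ξ) + B(ξ)α(ξ) + w₂] ≤ −λ V(x,ξ). Define M(x) as the second derivative of ξ ↦ V(x, ξ) at ξ = x. Then: (i) 2a₁ I ⪯ M(x) ⪯ 2a₂ I; (ii) M satisfies condition (PDE); (iii) there exists γ₀ > 0 (in fact γ₀ = 4a₂/c works) such that for every x ∈ ℝⁿ and all v, e ∈ ℝⁿ with B(x)ᵀ M(x) v = 0: vᵀ(∂_f M(x) + Df(x)ᵀ M(x) + M(x) Df(x)) v + λ vᵀ M(x) v + 2 vᵀ M(x) e ≤ γ₀ ‖e‖². -/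
/- STATEMENT 7: necessity of the robust CCM conditions for universal tracking of
the perturbed system ẋ = f(x) + B(x)u + w. Euclidean norms are written via
`Real.sqrt (v ⬝ᵥ v)`. -/

open Matrix

attribute [local instance] Matrix.normedAddCommGroup Matrix.normedSpace

/-- Second derivative of `ξ ↦ V x ξ` evaluated at `ξ = x`, as a matrix. -/
noncomputable def hess2 {n : ℕ} (V : (Fin n → ℝ) → (Fin n → ℝ) → ℝ) (x : Fin n → ℝ) :
    Matrix (Fin n) (Fin n) ℝ :=
  Matrix.of fun i j => fderiv ℝ (fun ξ => fderiv ℝ (V x) ξ (Pi.single j 1)) x (Pi.single i 1)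

section

open Filter Topology

lemma bdd_lin_zero {E : Type*} [NormedAddCommGroup E] [NormedSpace ℝ E] (L : E →L[ℝ] ℝ) (C : ℝ)
    (h : ∀ w, L w ≤ C) : L = 0 := by
  ext w
  by_contra hne
  have hne' : L w ≠ 0 := by simpa using hne
  have := h (((C + 1) / L w) • w)
  rw [map_smul, smul_eq_mul, div_mul_cancel₀ _ hne'] at this
  linarith

lemma transl_inv {n : ℕ} (V : (Fin n → ℝ) → (Fin n → ℝ) → ℝ)
    (hV : ContDiff ℝ 2 (fun p : (Fin n → ℝ) × (Fin n → ℝ) => V p.1 p.2))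
    (h : ∀ x ξ w, fderiv ℝ (fun y => V y ξ) x w + fderiv ℝ (fun y => V x y) ξ w = 0)
    (x ξ : Fin n → ℝ) : V x ξ = V (x - ξ) 0 := by
  have hd : Differentiable ℝ (fun p : (Fin n → ℝ) × (Fin n → ℝ) => V p.1 p.2) :=
    hV.differentiable (by norm_num)
  set G := fun p : (Fin n → ℝ) × (Fin n → ℝ) => V p.1 p.2 with hG
  have h1 : ∀ x ξ w, fderiv ℝ (fun y => V y ξ) x w = fderiv ℝ G (x, ξ) (w, 0) := by
    intro x ξ w
    have := HasFDerivAt.comp (𝕜 := ℝ) x (hd (x, ξ)).hasFDerivAt (hasFDerivAt_prodMk_left x ξ)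
    have e : fderiv ℝ (fun y => V y ξ) x = _ := this.fderiv
    rw [e]; simp
  have h2 : ∀ x ξ w, fderiv ℝ (fun y => V x y) ξ w = fderiv ℝ G (x, ξ) (0, w) := by
    intro x ξ w
    have := HasFDerivAt.comp (𝕜 := ℝ) ξ (hd (x, ξ)).hasFDerivAt (hasFDerivAt_prodMk_right x ξ)
    have e : fderiv ℝ (fun y => V x y) ξ = _ := this.fderiv
    rw [e]; simp
  have h3 : ∀ t : ℝ, HasDerivAt (fun t : ℝ => G (x + t • ξ, ξ + t • ξ)) 0 t := by
    intro t
    have ha : HasDerivAt (fun t : ℝ => x + t • ξ) ξ t := by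
      simpa using ((hasDerivAt_id t).smul_const ξ).const_add x
    have hb : HasDerivAt (fun t : ℝ => ξ + t • ξ) ξ t := by
      simpa using ((hasDerivAt_id t).smul_const ξ).const_add ξ
    have := (hd (x + t • ξ, ξ + t • ξ)).hasFDerivAt.comp_hasDerivAt t (ha.prodMk hb)
    have e : fderiv ℝ G (x + t • ξ, ξ + t • ξ) (ξ, ξ) = 0 := by
      have := h (x + t • ξ) (ξ + t • ξ) ξ
      rw [h1, h2, ← map_add] at this
      simpa using this
    rw [e] at this
    exact this
  have h4 := is_const_of_deriv_eq_zero (fun t => (h3 t).differentiableAt) (fun t => (h3 t).deriv)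
    0 (-1)
  simpa [hG, sub_eq_add_neg] using h4

lemma lim_DW {n : ℕ} (W : (Fin n → ℝ) → ℝ) (hW : ContDiff ℝ 2 W) (h0 : fderiv ℝ W 0 = 0)
    (v : Fin n → ℝ) :
    Tendsto (fun t : ℝ => t⁻¹ • fderiv ℝ W (t • v)) (𝓝[>] 0)
      (𝓝 (fderiv ℝ (fderiv ℝ W) 0 v)) := by
  have hd : Differentiable ℝ (fderiv ℝ W) :=
    (hW.fderiv_right (m := 1) (by norm_num)).differentiable (by norm_num)
  have ha : HasDerivAt (fun t : ℝ => t • v) v 0 := by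
    simpa using (hasDerivAt_id (0:ℝ)).smul_const v
  have hc : HasFDerivAt (fderiv ℝ W) (fderiv ℝ (fderiv ℝ W) 0) ((0:ℝ) • v) := by
    rw [zero_smul]; exact (hd 0).hasFDerivAt
  have := (hc.comp_hasDerivAt (0:ℝ) ha).tendsto_slope_zero_right
  simpa [h0] using this

lemma lim_W {n : ℕ} (W : (Fin n → ℝ) → ℝ) (hW : ContDiff ℝ 2 W) (hW0 : W 0 = 0)
    (h0 : fderiv ℝ W 0 = 0) (v : Fin n → ℝ) :
    Tendsto (fun t : ℝ => W (t • v) / t ^ 2) (𝓝[>] 0)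
      (𝓝 (fderiv ℝ (fderiv ℝ W) 0 v v / 2)) := by
  have hd : Differentiable ℝ W := hW.differentiable (by norm_num)
  have ha : ∀ t : ℝ, HasDerivAt (fun t : ℝ => W (t • v)) (fderiv ℝ W (t • v) v) t := by
    intro t
    have ha : HasDerivAt (fun t : ℝ => t • v) v t := by
      simpa using (hasDerivAt_id t).smul_const v
    exact (hd (t • v)).hasFDerivAt.comp_hasDerivAt t ha
  have hb : ∀ t : ℝ, HasDerivAt (fun t : ℝ => t ^ 2) (2 * t) t := by
    intro t; simpa using hasDerivAt_pow 2 t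
  apply HasDerivAt.lhopital_zero_nhdsGT (f' := fun t => fderiv ℝ W (t • v) v)
    (g' := fun t => 2 * t)
  · exact Eventually.of_forall ha
  · exact Eventually.of_forall hb
  · filter_upwards [self_mem_nhdsWithin] with t ht
    have : (0:ℝ) < t := ht
    positivity
  · have := (ha 0).continuousAt.tendsto
    simp only [zero_smul, hW0] at this
    exact this.mono_left nhdsWithin_le_nhds
  · have := (hb 0).continuousAt.tendsto
    simp only [ne_eq, OfNat.ofNat_ne_zero, not_false_eq_true, zero_pow] at this
    exact this.mono_left nhdsWithin_le_nhds
  · have h1 := lim_DW W hW h0 v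
    have h2 : Tendsto (fun t : ℝ => (t⁻¹ • fderiv ℝ W (t • v)) v) (𝓝[>] 0)
      (𝓝 (fderiv ℝ (fderiv ℝ W) 0 v v)) :=
      ((ContinuousLinearMap.apply ℝ ℝ v).continuous.tendsto _).comp h1
    refine (h2.div_const 2).congr ?_
    intro t
    simp only [_root_.smul_apply, smul_eq_mul]
    rw [div_eq_mul_inv, div_eq_mul_inv, mul_inv]; ring

lemma jacM_mulVec {ι κ : Type*} [Fintype ι] [DecidableEq ι] [Fintype κ]
    (f : (ι → ℝ) → (κ → ℝ)) (x v : ι → ℝ) : jacM f x *ᵥ v = fderiv ℝ f x v := by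
  have hv : v = ∑ j, v j • (Pi.single j (1:ℝ) : ι → ℝ) := by
    ext i; simp [Finset.sum_apply, Pi.single_apply]
  conv_rhs => rw [hv]
  ext k
  simp [jacM, mulVec, dotProduct, map_sum, Finset.sum_apply, mul_comm]

lemma bilin_mulVec {n : ℕ} (H : (Fin n → ℝ) →L[ℝ] (Fin n → ℝ) →L[ℝ] ℝ) (v u : Fin n → ℝ) :
    v ⬝ᵥ ((Matrix.of fun i j => H (Pi.single i 1) (Pi.single j 1)) *ᵥ u) = H v u := by
  have hv : ∀ v : Fin n → ℝ, v = ∑ j, v j • (Pi.single j (1:ℝ) : Fin n → ℝ) := by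
    intro v; ext i; simp [Finset.sum_apply, Pi.single_apply]
  conv_rhs => rw [hv v, hv u]
  simp only [mulVec, dotProduct, map_sum, map_smul, Matrix.of_apply,
    _root_.sum_apply, _root_.smul_apply, smul_eq_mul, Finset.mul_sum]
  rw [Finset.sum_comm]
  refine Finset.sum_congr rfl fun i _ => Finset.sum_congr rfl fun j _ => by ring

lemma hess2_eq {n : ℕ} (V : (Fin n → ℝ) → (Fin n → ℝ) → ℝ) (W : (Fin n → ℝ) → ℝ)
    (hW : ContDiff ℝ 2 W) (hVW : ∀ x ξ, V x ξ = W (x - ξ)) (x : Fin n → ℝ) :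
    hess2 V x = Matrix.of fun i j => fderiv ℝ (fderiv ℝ W) 0 (Pi.single i 1) (Pi.single j 1) := by
  have hd : Differentiable ℝ (fderiv ℝ W) :=
    (hW.fderiv_right (m := 1) (by norm_num)).differentiable (by norm_num)
  have e : ∀ ξ, fderiv ℝ (V x) ξ = - fderiv ℝ W (x - ξ) := by
    intro ξ
    have : V x = fun ξ => W (x - ξ) := funext (hVW x)
    rw [this]
    have hs : HasFDerivAt (fun ξ : Fin n → ℝ => x - ξ) (-ContinuousLinearMap.id ℝ (Fin n → ℝ)) ξ :=
      (hasFDerivAt_id ξ).const_sub x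
    have h := ((hW.differentiable (by norm_num)) (x - ξ)).hasFDerivAt.comp ξ hs
    have h' : fderiv ℝ (fun ξ => W (x - ξ)) ξ = _ := h.fderiv
    rw [h']; ext; simp
  ext i j
  simp only [hess2, Matrix.of_apply, e]
  have h1 : HasFDerivAt (fun ξ => fderiv ℝ W (x - ξ))
      ((fderiv ℝ (fderiv ℝ W) 0).comp (-ContinuousLinearMap.id ℝ (Fin n → ℝ))) x := by
    have hs : HasFDerivAt (fun ξ : Fin n → ℝ => x - ξ) (-ContinuousLinearMap.id ℝ (Fin n → ℝ)) x :=
      (hasFDerivAt_id x).const_sub x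
    have hc : HasFDerivAt (fderiv ℝ W) (fderiv ℝ (fderiv ℝ W) 0) (x - x) := by
      rw [sub_self]; exact (hd 0).hasFDerivAt
    exact hc.comp x hs
  have h2 := (ContinuousLinearMap.apply ℝ ℝ (Pi.single j (1:ℝ) : Fin n → ℝ)).hasFDerivAt.comp x
    h1.neg
  have h3 : fderiv ℝ (fun ξ => (-fderiv ℝ W (x - ξ)) (Pi.single j (1:ℝ) : Fin n → ℝ)) x = _ :=
    h2.fderiv
  rw [h3]; simp

lemma F_deriv {n m : ℕ} (f : (Fin n → ℝ) → (Fin n → ℝ))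
    (B : (Fin n → ℝ) → Matrix (Fin n) (Fin m) ℝ) (α : (Fin n → ℝ) → (Fin m → ℝ))
    (hf : Differentiable ℝ f) (hB : Differentiable ℝ B) (hα : Differentiable ℝ α)
    (x v : Fin n → ℝ) :
    HasDerivAt (fun t : ℝ => f (x + t • v) + B (x + t • v) *ᵥ α (x + t • v))
      (jacM f x *ᵥ v + (∑ i, α x i • (jacM (fun y k => B y k i) x *ᵥ v))
        + B x *ᵥ (jacM α x *ᵥ v)) 0 := by
  have hl : HasDerivAt (fun t : ℝ => x + t • v) v 0 := by
    simpa using ((hasDerivAt_id (0:ℝ)).smul_const v).const_add x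
  have hx : x + (0:ℝ) • v = x := by simp
  have gen : ∀ {G : Type} [NormedAddCommGroup G] [NormedSpace ℝ G] (g : (Fin n → ℝ) → G),
      Differentiable ℝ g → HasDerivAt (fun t : ℝ => g (x + t • v)) (fderiv ℝ g x v) 0 := by
    intro G _ _ g hg
    have hc : HasFDerivAt g (fderiv ℝ g x) (x + (0:ℝ) • v) := by
      rw [hx]; exact (hg x).hasFDerivAt
    exact hc.comp_hasDerivAt 0 hl
  have hBi : ∀ i, Differentiable ℝ (fun y k => B y k i) := by
    intro i
    rw [differentiable_pi]; intro k
    have h1 := differentiable_pi.1 hB k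
    exact differentiable_pi.1 h1 i
  have hfd := gen f hf
  have hαd := gen α hα
  have hBd := fun i => gen _ (hBi i)
  rw [hasDerivAt_pi] at hfd hαd ⊢
  intro k
  have hBd' := fun i => (hasDerivAt_pi.1 (hBd i)) k
  have hs := HasDerivAt.fun_sum (u := Finset.univ) (fun i _ => (hBd' i).mul (hαd i))
  have := (hfd k).add hs
  simp only [jacM_mulVec]
  refine this.congr_deriv ?_
  simp only [hx, Pi.add_apply, Finset.sum_apply, Pi.smul_apply, smul_eq_mul, mulVec, dotProduct,
    Finset.sum_add_distrib]
  rw [add_assoc]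
  congr 2
  exact Finset.sum_congr rfl fun i _ => mul_comm _ _

/-- the linearized inequality -/
lemma key_ineq {n : ℕ} (W : (Fin n → ℝ) → ℝ) (hW : ContDiff ℝ 2 W) (hW0 : W 0 = 0)
    (h0 : fderiv ℝ W 0 = 0) (lam : ℝ) (F : (Fin n → ℝ) → (Fin n → ℝ))
    (x v e D : Fin n → ℝ) (hF : HasDerivAt (fun t : ℝ => F (x + t • v)) D 0)
    (h : ∀ t : ℝ, 0 < t →
      fderiv ℝ W (t • v) (F (x + t • v) - F x + t • e) ≤ -lam * W (t • v)) :
    fderiv ℝ (fderiv ℝ W) 0 v (D + e) ≤ -lam * (fderiv ℝ (fderiv ℝ W) 0 v v / 2) := by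
  have h1 := lim_DW W hW h0 v
  have h2 := (lim_W W hW hW0 h0 v).const_mul (-lam)
  have h3 := hF.tendsto_slope_zero_right
  simp only [zero_add, zero_smul, add_zero] at h3
  have h4 := (isBoundedBilinearMap_apply (𝕜 := ℝ) (E := Fin n → ℝ) (F := ℝ)).continuous.tendsto
    (fderiv ℝ (fderiv ℝ W) 0 v, D + e) |>.comp (h1.prodMk_nhds (h3.add_const e))
  refine le_of_tendsto_of_tendsto h4 h2 ?_
  filter_upwards [self_mem_nhdsWithin] with t ht
  have ht : (0:ℝ) < t := ht
  have hh := h t ht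
  have e1 : (t⁻¹ • fderiv ℝ W (t • v)) (t⁻¹ • (F (x + t • v) - F x) + e)
      = fderiv ℝ W (t • v) (F (x + t • v) - F x + t • e) / t ^ 2 := by
    simp only [_root_.smul_apply, map_add, map_smul, smul_eq_mul]
    field_simp
  show (t⁻¹ • fderiv ℝ W (t • v)) (t⁻¹ • (F (x + t • v) - F x) + e) ≤ -lam * (W (t • v) / t ^ 2)
  rw [e1, ← mul_div_assoc]
  gcongr

end

theorem stmt7 {n m : ℕ} (hmn : m < n)
    (f : (Fin n → ℝ) → (Fin n → ℝ)) (B : (Fin n → ℝ) → Matrix (Fin n) (Fin m) ℝ)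
    (hf : ContDiff ℝ (⊤ : ℕ∞) f) (hB : ContDiff ℝ (⊤ : ℕ∞) B)
    (hBrank : ∀ x, Function.Injective (B x).mulVec)
    (V : (Fin n → ℝ) → (Fin n → ℝ) → ℝ)
    (hV : ContDiff ℝ 2 (fun p : (Fin n → ℝ) × (Fin n → ℝ) => V p.1 p.2))
    (a₁ a₂ : ℝ) (ha₁ : 0 < a₁) (ha₁₂ : a₁ ≤ a₂)
    (hVlow : ∀ x ξ, a₁ * ((x - ξ) ⬝ᵥ (x - ξ)) ≤ V x ξ)
    (hVup : ∀ x ξ, V x ξ ≤ a₂ * ((x - ξ) ⬝ᵥ (x - ξ)))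
    (lam c : ℝ) (hlam : 0 < lam) (hc : 0 < c)
    (K : (Fin n → ℝ) → Matrix (Fin m) (Fin n) ℝ) (hK : Continuous K)
    (hfeed : ∀ (xs : Fin n → ℝ) (us : Fin m → ℝ),
      ∃ α : (Fin n → ℝ) → (Fin m → ℝ), ContDiff ℝ 1 α ∧ α xs = us ∧ jacM α xs = K xs ∧
        ∀ (x ξ w₁ w₂ : Fin n → ℝ),
          Real.sqrt ((w₁ - w₂) ⬝ᵥ (w₁ - w₂)) ≤ c * Real.sqrt ((x - ξ) ⬝ᵥ (x - ξ)) →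
          fderiv ℝ (fun y => V y ξ) x (f x + (B x) *ᵥ (α x) + w₁)
            + fderiv ℝ (fun y => V x y) ξ (f ξ + (B ξ) *ᵥ (α ξ) + w₂)
            ≤ -lam * V x ξ) :
    -- (i) 2a₁ I ⪯ M(x) ⪯ 2a₂ I
    (∀ (x v : Fin n → ℝ), 2 * a₁ * (v ⬝ᵥ v) ≤ v ⬝ᵥ (hess2 V x *ᵥ v) ∧
        v ⬝ᵥ (hess2 V x *ᵥ v) ≤ 2 * a₂ * (v ⬝ᵥ v)) ∧
    -- (ii) condition (PDE)
    (∀ (i : Fin m) (x : Fin n → ℝ),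
       fderiv ℝ (hess2 V) x (fun k => B x k i)
         + (jacM (fun y k => B y k i) x)ᵀ * hess2 V x
         + hess2 V x * jacM (fun y k => B y k i) x = 0) ∧
    -- (iii) the robust CCM inequality, with γ₀ = 4a₂/c
    (∃ γ₀ : ℝ, γ₀ > 0 ∧ γ₀ = 4 * a₂ / c ∧
      ∀ (x v e : Fin n → ℝ), (B x)ᵀ *ᵥ (hess2 V x *ᵥ v) = 0 →
        v ⬝ᵥ ((fderiv ℝ (hess2 V) x (f x) + (jacM f x)ᵀ * hess2 V x
              + hess2 V x * jacM f x) *ᵥ v)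
          + lam * (v ⬝ᵥ (hess2 V x *ᵥ v)) + 2 * (v ⬝ᵥ (hess2 V x *ᵥ e))
          ≤ γ₀ * (e ⬝ᵥ e)) := by
  classical
  -- translation invariance
  have hsum : ∀ x ξ w, fderiv ℝ (fun y => V y ξ) x w + fderiv ℝ (fun y => V x y) ξ w = 0 := by
    intro x ξ w
    obtain ⟨α, -, -, -, hα⟩ := hfeed 0 0
    have := bdd_lin_zero (fderiv ℝ (fun y => V y ξ) x + fderiv ℝ (fun y => V x y) ξ)
      (-lam * V x ξ - (fderiv ℝ (fun y => V y ξ) x (f x + (B x) *ᵥ (α x))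
            + fderiv ℝ (fun y => V x y) ξ (f ξ + (B ξ) *ᵥ (α ξ)))) (by
        intro w
        have := hα x ξ w w (by
          simp only [sub_self, dotProduct_zero, Real.sqrt_zero]
          positivity)
        rw [map_add _ _ w, map_add _ _ w] at this
        simp only [_root_.add_apply]
        linarith)
    have h2 := congrArg (fun L => L w) this
    simpa using h2
  obtain ⟨W, hWdef⟩ : ∃ W : (Fin n → ℝ) → ℝ, W = fun z => V z 0 := ⟨_, rfl⟩
  have hVW : ∀ x ξ, V x ξ = W (x - ξ) := by
    intro x ξ; rw [hWdef]; exact transl_inv V hV hsum x ξ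
  have hW : ContDiff ℝ 2 W := by
    rw [hWdef]
    exact hV.comp (contDiff_id.prodMk contDiff_const)
  have hWlow : ∀ z, a₁ * (z ⬝ᵥ z) ≤ W z := by
    intro z; simpa [hWdef] using hVlow z 0
  have hWup : ∀ z, W z ≤ a₂ * (z ⬝ᵥ z) := by
    intro z; simpa [hWdef] using hVup z 0
  have hnn : ∀ z : Fin n → ℝ, 0 ≤ z ⬝ᵥ z := fun z =>
    Finset.sum_nonneg fun i _ => mul_self_nonneg (z i)
  have hW0 : W 0 = 0 := by
    have h1 := hWlow 0
    have h2 := hWup 0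
    simp only [dotProduct_zero, mul_zero] at h1 h2
    exact le_antisymm h2 h1
  have h0 : fderiv ℝ W 0 = 0 := by
    apply IsLocalMin.fderiv_eq_zero
    refine Filter.Eventually.of_forall fun z => ?_
    rw [hW0]
    exact le_trans (mul_nonneg ha₁.le (hnn z)) (hWlow z)
  have hM := hess2_eq V W hW hVW
  obtain ⟨H, hH⟩ : ∃ H, H = fderiv ℝ (fderiv ℝ W) 0 := ⟨_, rfl⟩
  have hbil : ∀ x v u, v ⬝ᵥ (hess2 V x *ᵥ u) = H v u := by
    intro x v u; rw [hM, hH]; exact bilin_mulVec _ v u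
  have hsymm : ∀ u v, H u v = H v u := by
    intro u v
    rw [hH]
    exact (hW.contDiffAt.isSymmSndFDerivAt (by simp)).eq u v
  have hlim := fun v => lim_W W hW hW0 h0 v
  have hscale : ∀ (t : ℝ) (v : Fin n → ℝ), (t • v) ⬝ᵥ (t • v) = t ^ 2 * (v ⬝ᵥ v) := by
    intro t v; simp only [smul_dotProduct, dotProduct_smul, smul_eq_mul]; ring
  have hHlow : ∀ v, 2 * a₁ * (v ⬝ᵥ v) ≤ H v v := by
    intro v
    have := ge_of_tendsto (hlim v) (b := a₁ * (v ⬝ᵥ v)) (by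
      filter_upwards [self_mem_nhdsWithin] with t ht
      have ht : (0:ℝ) < t := ht
      have h := hWlow (t • v)
      rw [hscale] at h
      rw [le_div_iff₀ (by positivity)]
      linarith)
    rw [hH]; linarith
  have hHup : ∀ v, H v v ≤ 2 * a₂ * (v ⬝ᵥ v) := by
    intro v
    have := le_of_tendsto (hlim v) (b := a₂ * (v ⬝ᵥ v)) (by
      filter_upwards [self_mem_nhdsWithin] with t ht
      have ht : (0:ℝ) < t := ht
      have h := hWup (t • v)
      rw [hscale] at h
      rw [div_le_iff₀ (by positivity)]
      linarith)
    rw [hH]; linarith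
  have hfD : fderiv ℝ (hess2 V) = 0 := by
    have : hess2 V = fun _ => Matrix.of fun i j =>
        fderiv ℝ (fderiv ℝ W) 0 (Pi.single i 1) (Pi.single j 1) := funext hM
    rw [this]
    ext1 x
    simp
  have hWd := hW.differentiable (by norm_num)
  have hD1 : ∀ x ξ, fderiv ℝ (fun y => V y ξ) x = fderiv ℝ W (x - ξ) := by
    intro x ξ
    have : (fun y => V y ξ) = fun y => W (y - ξ) := funext fun y => hVW y ξ
    rw [this]
    have hs : HasFDerivAt (fun y : Fin n → ℝ => y - ξ) (ContinuousLinearMap.id ℝ (Fin n → ℝ)) x :=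
      (hasFDerivAt_id x).sub_const ξ
    have h := (hWd (x - ξ)).hasFDerivAt.comp x hs
    have h' : fderiv ℝ (fun y => W (y - ξ)) x = _ := h.fderiv
    rw [h']; ext; simp
  have hkey : ∀ (xs : Fin n → ℝ) (us : Fin m → ℝ) (v e : Fin n → ℝ),
      e ⬝ᵥ e ≤ c ^ 2 * (v ⬝ᵥ v) →
      H v (jacM f xs *ᵥ v + (∑ i, us i • (jacM (fun y k => B y k i) xs *ᵥ v))
        + B xs *ᵥ (K xs *ᵥ v) + e) ≤ -lam * (H v v / 2) := by
    intro xs us v e he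
    obtain ⟨α, hα1, hα2, hα3, hα⟩ := hfeed xs us
    have hF := F_deriv f B α (hf.differentiable (by simp)) (hB.differentiable (by simp))
      (hα1.differentiable (by norm_num)) xs v
    rw [hα2, hα3] at hF
    rw [hH]
    refine key_ineq W hW hW0 h0 lam (fun x => f x + B x *ᵥ α x) xs v e _ hF ?_
    intro t ht
    have h1 := hα (xs + t • v) xs (t • e) 0 (by
      rw [sub_zero, add_sub_cancel_left, hscale, hscale]
      rw [show c * Real.sqrt (t ^ 2 * (v ⬝ᵥ v)) = Real.sqrt (c ^ 2 * (t ^ 2 * (v ⬝ᵥ v))) by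
        rw [Real.sqrt_mul (sq_nonneg c), Real.sqrt_sq hc.le]]
      apply Real.sqrt_le_sqrt
      nlinarith [sq_nonneg t])
    have h2 := hsum (xs + t • v) xs (f xs + (B xs) *ᵥ (α xs))
    rw [add_zero] at h1
    rw [hVW, add_sub_cancel_left] at h1
    rw [hD1, add_sub_cancel_left] at h1 h2
    simp only [map_add, map_sub] at h1 h2 ⊢
    linarith
  have hPDE : ∀ (i : Fin m) (x v : Fin n → ℝ), H v (jacM (fun y k => B y k i) x *ᵥ v) = 0 := by
    intro i x v
    have hb : ∀ s : ℝ, s * H v (jacM (fun y k => B y k i) x *ᵥ v) ≤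
        -lam * (H v v / 2) - H v (jacM f x *ᵥ v) - H v (B x *ᵥ (K x *ᵥ v)) := by
      intro s
      have h := hkey x (Pi.single i s) v 0 (by
        simp only [dotProduct_zero]
        exact mul_nonneg (sq_nonneg c) (hnn v))
      have e1 : (∑ j, (Pi.single i s : Fin m → ℝ) j • (jacM (fun y k => B y k j) x *ᵥ v))
          = s • (jacM (fun y k => B y k i) x *ᵥ v) := by
        rw [Finset.sum_eq_single i]
        · simp
        · intro j _ hj; simp [hj]
        · simp
      rw [e1] at h
      simp only [map_add, map_smul, smul_eq_mul, map_zero] at h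
      linarith
    have := bdd_lin_zero (ContinuousLinearMap.toSpanSingleton ℝ
      (H v (jacM (fun y k => B y k i) x *ᵥ v))) _ (by
        intro s
        simpa using hb s)
    have h2 := congrArg (fun L => L (1:ℝ)) this
    simpa using h2
  have hT : ∀ (J : Matrix (Fin n) (Fin n) ℝ) (x u w : Fin n → ℝ),
      u ⬝ᵥ ((Jᵀ * hess2 V x + hess2 V x * J) *ᵥ w) = H w (J *ᵥ u) + H u (J *ᵥ w) := by
    intro J x u w
    rw [add_mulVec, dotProduct_add, ← mulVec_mulVec, ← mulVec_mulVec, hbil,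
      dotProduct_mulVec, vecMul_transpose, hbil, hsymm]
  refine ⟨fun x v => ⟨?_, ?_⟩, ?_, 4 * a₂ / c, ?_, rfl, ?_⟩
  · rw [hbil]; exact hHlow v
  · rw [hbil]; exact hHup v
  · intro i x
    have hz : fderiv ℝ (hess2 V) x (fun k => B x k i) = 0 := by rw [hfD]; rfl
    rw [hz, zero_add]
    ext k l
    have h1 := hT (jacM (fun y k => B y k i) x) x (Pi.single k 1) (Pi.single l 1)
    have h2 := hPDE i x (Pi.single k 1 + Pi.single l 1)
    have h3 := hPDE i x (Pi.single k 1)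
    have h4 := hPDE i x (Pi.single l 1)
    rw [mulVec_add, map_add, map_add, _root_.add_apply, _root_.add_apply] at h2
    rw [single_one_dotProduct, mulVec_single_one] at h1
    simp only [Matrix.col_apply] at h1
    rw [h1, Matrix.zero_apply]
    linarith
  · have : 0 < a₂ := lt_of_lt_of_le ha₁ ha₁₂
    positivity
  · intro x v e hv
    have hz : fderiv ℝ (hess2 V) x (f x) = 0 := by rw [hfD]; rfl
    rw [hz, zero_add, hT, hbil, hbil]
    have ha₂ : 0 < a₂ := lt_of_lt_of_le ha₁ ha₁₂
    have hBK : H v (B x *ᵥ (K x *ᵥ v)) = 0 := by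
      rw [hsymm, ← hbil x, dotProduct_comm, dotProduct_mulVec, ← mulVec_transpose, hv,
        zero_dotProduct]
    by_cases he : e ⬝ᵥ e ≤ c ^ 2 * (v ⬝ᵥ v)
    · have h := hkey x 0 v e he
      simp only [map_add, Pi.zero_apply, zero_smul, Finset.sum_const_zero, map_zero, hBK] at h
      have : 0 ≤ 4 * a₂ / c * (e ⬝ᵥ e) := mul_nonneg (by positivity) (hnn e)
      linarith
    · push Not at he
      have h := hkey x 0 v 0 (by
        simp only [dotProduct_zero]
        exact mul_nonneg (sq_nonneg c) (hnn v))
      simp only [map_add, Pi.zero_apply, zero_smul, Finset.sum_const_zero, map_zero, hBK] at h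
      have hpos : 0 ≤ H (c • v - e) (c • v - e) :=
        le_trans (mul_nonneg (by positivity) (hnn _)) (hHlow _)
      simp only [map_sub, map_smul, _root_.sub_apply, _root_.smul_apply, smul_eq_mul,
        hsymm e v] at hpos
      have h5 := mul_le_mul_of_nonneg_left (hHup v) (sq_nonneg c)
      have h6 := hHup e
      have h7 := mul_lt_mul_of_pos_left he ha₂
      have h8 : 2 * H v e ≤ 4 * a₂ / c * (e ⬝ᵥ e) := by
        rw [div_mul_eq_mul_div, le_div_iff₀ hc]
        nlinarith
      linarith
end
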